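/- Let a, b be complex numbers such that a + b ≠ 0, neither a nor b is a negative integer, and (a+b)/2 is not a nonpositive integer. Let c : ℕ → ℂ be any sequence such that the series Σ_n c(n)·(a)_n/((a+1)_n) and Σ_n c(n)·(b)_n/((b+1)_n) both converge absolutely. Then the series Σ_n c(n)·(a)_n·(b)_n·((a+b)/2+1)_n / ( (a+1)_n·(b+1)_n·((a+b)/2)_n ) converges absolutely and its sum equals (b/(a+b))·Σ_{n=0}^∞ c(n)·(a)_n/((a+1)_n) + (a/(a+b))·Σ_{n=0}^∞ c(n)·(b)_n/((b+1)_n). -/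

import Mathlib

/-- The two ways of splitting one factor off the rising factorial `(x)_{n+1}`. -/
theorem ascPochhammer_eval_mul_add_natCast {R : Type*} [CommRing R] (n : ℕ) (x : R) :
    (ascPochhammer R n).eval x * (x + n) = x * (ascPochhammer R n).eval (x + 1) := by
  rw [← ascPochhammer_succ_eval, ascPochhammer_succ_left]
  simp [Polynomial.eval_comp]

theorem ascPochhammer_eval_ne_zero {R : Type*} [CommRing R] [IsDomain R] {x : R}
    (hx : ∀ n : ℕ, x ≠ -(n : R)) (n : ℕ) : (ascPochhammer R n).eval x ≠ 0 := by
  induction n with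
  | zero => simp
  | succ n ih =>
    rw [ascPochhammer_succ_eval]
    exact mul_ne_zero ih fun h => hx n (eq_neg_of_add_eq_zero_left h)

/-- The partial fraction decomposition behind the reduction of the well-poised triple. -/
theorem ascPochhammer_wellPoised_partial_fraction {K : Type*} [Field K] [CharZero K] {a b : K}
    (hab : a + b ≠ 0)
    (ha : ∀ n : ℕ, a ≠ -((n : K) + 1)) (hb : ∀ n : ℕ, b ≠ -((n : K) + 1))
    (hab2 : ∀ n : ℕ, (a + b) / 2 ≠ -(n : K)) (c : K) (n : ℕ) :
    c * (ascPochhammer K n).eval a * (ascPochhammer K n).eval b *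
          (ascPochhammer K n).eval ((a + b) / 2 + 1) /
        ((ascPochhammer K n).eval (a + 1) * (ascPochhammer K n).eval (b + 1) *
          (ascPochhammer K n).eval ((a + b) / 2)) =
      b / (a + b) * (c * (ascPochhammer K n).eval a / (ascPochhammer K n).eval (a + 1)) +
        a / (a + b) * (c * (ascPochhammer K n).eval b / (ascPochhammer K n).eval (b + 1)) := by
  have hA : (ascPochhammer K n).eval (a + 1) ≠ 0 :=
    ascPochhammer_eval_ne_zero (fun k h => ha k (by linear_combination h)) n
  have hB : (ascPochhammer K n).eval (b + 1) ≠ 0 :=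
    ascPochhammer_eval_ne_zero (fun k h => hb k (by linear_combination h)) n
  have hS : (ascPochhammer K n).eval ((a + b) / 2) ≠ 0 := ascPochhammer_eval_ne_zero hab2 n
  have ea := ascPochhammer_eval_mul_add_natCast n a
  have eb := ascPochhammer_eval_mul_add_natCast n b
  have es := ascPochhammer_eval_mul_add_natCast n ((a + b) / 2)
  generalize (ascPochhammer K n).eval ((a + b) / 2 + 1) = S' at *
  generalize (ascPochhammer K n).eval ((a + b) / 2) = S at *
  generalize (ascPochhammer K n).eval (a + 1) = A' at *
  generalize (ascPochhammer K n).eval (b + 1) = B' at *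
  generalize (ascPochhammer K n).eval a = A at *
  generalize (ascPochhammer K n).eval b = B at *
  have es' : S' * (a + b) = S * (a + b + 2 * n) := by
    linear_combination (-2) * es
  field_simp
  linear_combination c * A * B * es' + c * S * B * ea + c * S * A * eb

/-- The hypergeometric reduction identity: a series with the well-poised triple
`((a+b)/2+1, a, b ; (a+b)/2, a+1, b+1)` splits as a combination of two simpler series. -/
theorem hypergeometric_reduction (a b : ℂ) (hab : a + b ≠ 0)
    (ha : ∀ n : ℕ, a ≠ -((n : ℂ) + 1)) (hb : ∀ n : ℕ, b ≠ -((n : ℂ) + 1))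
    (hab2 : ∀ n : ℕ, (a + b) / 2 ≠ -(n : ℂ))
    (c : ℕ → ℂ)
    (hca : Summable (fun n : ℕ =>
      ‖c n * (ascPochhammer ℂ n).eval a / (ascPochhammer ℂ n).eval (a + 1)‖))
    (hcb : Summable (fun n : ℕ =>
      ‖c n * (ascPochhammer ℂ n).eval b / (ascPochhammer ℂ n).eval (b + 1)‖)) :
    Summable (fun n : ℕ =>
      ‖c n * (ascPochhammer ℂ n).eval a * (ascPochhammer ℂ n).eval b *
          (ascPochhammer ℂ n).eval ((a + b) / 2 + 1) /
        ((ascPochhammer ℂ n).eval (a + 1) * (ascPochhammer ℂ n).eval (b + 1) *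
          (ascPochhammer ℂ n).eval ((a + b) / 2))‖) ∧
    (∑' n : ℕ, c n * (ascPochhammer ℂ n).eval a * (ascPochhammer ℂ n).eval b *
          (ascPochhammer ℂ n).eval ((a + b) / 2 + 1) /
        ((ascPochhammer ℂ n).eval (a + 1) * (ascPochhammer ℂ n).eval (b + 1) *
          (ascPochhammer ℂ n).eval ((a + b) / 2))) =
      b / (a + b) *
          ∑' n : ℕ, c n * (ascPochhammer ℂ n).eval a / (ascPochhammer ℂ n).eval (a + 1) +
        a / (a + b) *
          ∑' n : ℕ, c n * (ascPochhammer ℂ n).eval b / (ascPochhammer ℂ n).eval (b + 1) := by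
  have hterm := fun n => ascPochhammer_wellPoised_partial_fraction hab ha hb hab2 (c n) n
  have hsa := hca.of_norm.mul_left (b / (a + b))
  have hsb := hcb.of_norm.mul_left (a / (a + b))
  simp_rw [hterm]
  exact ⟨(hsa.add hsb).norm, by rw [hsa.tsum_add hsb, tsum_mul_left, tsum_mul_left]⟩
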